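/- arXiv:2407.08517 — 5 statements merged into one kernel-verified Lean document; each statement's English description precedes it below -/
import Mathlib

section
/- (Von Neumann trace inequality) Let M and N be n₁×n₂ real matrices with singular value decompositions M = U S Vᵀ and N = Q Σ Rᵀ, where U, V, Q, R are orthogonal and S, Σ are rectangular diagonal matrices with descending nonnegative diagonal entries s₁ ≥ … ≥ s_r ≥ 0 and σ₁ ≥ … ≥ σ_r ≥ 0, r = min{n₁,n₂}. Then tr(Mᵀ N) ≤ Σ_{i=1}^{r} s_i σ_i. -/
open Matrix

/-- Rectangular diagonal matrix with diagonal entries given by `σ`. -/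
def rectDiag (n₁ n₂ : ℕ) (σ : ℕ → ℝ) : Matrix (Fin n₁) (Fin n₂) ℝ :=
  fun i j => if (i : ℕ) = (j : ℕ) then σ (i : ℕ) else 0

lemma vn_abel (x c : ℕ → ℝ) (r : ℕ)
    (hx : ∀ i j : ℕ, i ≤ j → j < r → x j ≤ x i) (hx0 : ∀ i, i < r → 0 ≤ x i)
    (hc : ∀ k, k ≤ r → 0 ≤ ∑ i ∈ Finset.range k, c i) :
    0 ≤ ∑ i ∈ Finset.range r, x i * c i := by
  have key : ∀ k, k < r → x k * ∑ i ∈ Finset.range (k + 1), c i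
      ≤ ∑ i ∈ Finset.range (k + 1), x i * c i := by
    intro k
    induction k with
    | zero => intro _; simp
    | succ k ih =>
      intro hk
      have h1 := ih (by omega)
      have h2 := mul_le_mul_of_nonneg_right (hx k (k + 1) (by omega) hk) (hc (k + 1) (by omega))
      rw [Finset.sum_range_succ _ (k + 1), Finset.sum_range_succ _ (k + 1), mul_add]
      linarith
  cases r with
  | zero => simp
  | succ k =>
    exact le_trans (mul_nonneg (hx0 k (by omega)) (hc (k + 1) le_rfl)) (key k (by omega))

lemma vn_comb (x y : ℕ → ℝ) (p : ℕ → ℕ → ℝ) (r : ℕ)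
    (hx : ∀ i j : ℕ, i ≤ j → j < r → x j ≤ x i) (hx0 : ∀ i, i < r → 0 ≤ x i)
    (hy : ∀ i j : ℕ, i ≤ j → j < r → y j ≤ y i) (hy0 : ∀ i, i < r → 0 ≤ y i)
    (hp : ∀ i j, 0 ≤ p i j)
    (hr : ∀ i, i < r → ∑ j ∈ Finset.range r, p i j ≤ 1)
    (hc : ∀ j, j < r → ∑ i ∈ Finset.range r, p i j ≤ 1) :
    ∑ i ∈ Finset.range r, ∑ j ∈ Finset.range r, x i * (y j * p i j)
      ≤ ∑ i ∈ Finset.range r, x i * y i := by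
  have h := vn_abel x (fun i => y i - ∑ j ∈ Finset.range r, y j * p i j) r hx hx0 ?_
  · simp only [mul_sub, Finset.mul_sum, Finset.sum_sub_distrib] at h
    linarith
  intro k hk
  have h2 := vn_abel y (fun j => (if j < k then 1 else 0) - ∑ i ∈ Finset.range k, p i j) r hy hy0 ?_
  · have e1 : ∑ i ∈ Finset.range r, y i * (if i < k then (1 : ℝ) else 0)
        = ∑ i ∈ Finset.range k, y i := by
      simp only [mul_ite, mul_one, mul_zero]
      rw [← Finset.sum_filter]
      congr 1
      ext i
      simp only [Finset.mem_filter, Finset.mem_range]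
      omega
    simp only [mul_sub, Finset.mul_sum, Finset.sum_sub_distrib] at h2 ⊢
    rw [Finset.sum_comm (s := Finset.range k)]
    linarith
  intro l hl
  rw [Finset.sum_sub_distrib]
  have e2 : ∑ j ∈ Finset.range l, (if j < k then (1 : ℝ) else 0) = ((min l k : ℕ) : ℝ) := by
    rw [← Finset.sum_filter]
    have : (Finset.range l).filter (fun j => j < k) = Finset.range (min l k) := by
      ext i
      simp only [Finset.mem_filter, Finset.mem_range]
      omega
    rw [this]; simp
  rw [e2, sub_nonneg]
  have b1 : ∑ j ∈ Finset.range l, ∑ i ∈ Finset.range k, p i j ≤ l := by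
    calc _ ≤ ∑ j ∈ Finset.range l, (1 : ℝ) := by
          refine Finset.sum_le_sum fun j hj => ?_
          refine le_trans ?_ (hc j (by have := Finset.mem_range.1 hj; omega))
          exact Finset.sum_le_sum_of_subset_of_nonneg (Finset.range_mono hk) (fun i _ _ => hp i j)
      _ = l := by simp
  have b2 : ∑ j ∈ Finset.range l, ∑ i ∈ Finset.range k, p i j ≤ k := by
    rw [Finset.sum_comm]
    calc _ ≤ ∑ j ∈ Finset.range k, (1 : ℝ) := by
          refine Finset.sum_le_sum fun j hj => ?_
          refine le_trans ?_ (hr j (by have := Finset.mem_range.1 hj; omega))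
          exact Finset.sum_le_sum_of_subset_of_nonneg (Finset.range_mono hl) (fun i _ _ => hp j i)
      _ = k := by simp
  rw [Nat.cast_min]
  exact le_min b1 b2

lemma vn_fin (x y : ℕ → ℝ) (r : ℕ) (p : Fin r → Fin r → ℝ)
    (hx : ∀ i j : ℕ, i ≤ j → j < r → x j ≤ x i) (hx0 : ∀ i, i < r → 0 ≤ x i)
    (hy : ∀ i j : ℕ, i ≤ j → j < r → y j ≤ y i) (hy0 : ∀ i, i < r → 0 ≤ y i)
    (hp : ∀ i j, 0 ≤ p i j)
    (hr : ∀ i, ∑ j, p i j ≤ 1)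
    (hc : ∀ j, ∑ i, p i j ≤ 1) :
    ∑ i : Fin r, ∑ j : Fin r, x i * (y j * p i j)
      ≤ ∑ i ∈ Finset.range r, x i * y i := by
  have h := vn_comb x y (fun i j => if h : i < r ∧ j < r then p ⟨i, h.1⟩ ⟨j, h.2⟩ else 0) r
    hx hx0 hy hy0 ?_ ?_ ?_
  · refine le_trans (le_of_eq ?_) h
    simp [Finset.sum_range]
  · intro i j
    split_ifs
    · exact hp _ _
    · exact le_rfl
  · intro i hi
    simpa [Finset.sum_range, hi] using hr ⟨i, hi⟩
  · intro i hi
    simpa [Finset.sum_range, hi] using hc ⟨i, hi⟩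

lemma vn_rect (n₁ n₂ : ℕ) (s : ℕ → ℝ) (f : Fin n₁ → Fin n₂ → ℝ) :
    ∑ i, ∑ k, rectDiag n₁ n₂ s i k * f i k
      = ∑ i : Fin (min n₁ n₂), s i * f (Fin.castLE (min_le_left _ _) i)
          (Fin.castLE (min_le_right _ _) i) := by
  rw [← Finset.sum_product']
  symm
  refine Finset.sum_of_injOn
    (fun i => (Fin.castLE (min_le_left _ _) i, Fin.castLE (min_le_right _ _) i)) ?_ ?_ ?_ ?_
  · intro a _ b _ hab
    simpa using hab
  · intro a _; simp
  · rintro ⟨a, b⟩ _ hab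
    have : (a : ℕ) ≠ b := by
      intro e
      apply hab
      refine ⟨⟨a, by have := a.2; have := b.2; omega⟩, by simp, ?_⟩
      ext <;> simp [e]
    simp [rectDiag, this]
  · intro i _
    simp [rectDiag]

lemma vn_sq {n r : ℕ} (h : r ≤ n) (A : Matrix (Fin n) (Fin n) ℝ) (hA : A * Aᵀ = 1) (i : Fin n) :
    ∑ j : Fin r, A i (Fin.castLE h j) ^ 2 ≤ 1 := by
  have e : ∑ j, A i j ^ 2 = 1 := by
    have := congrFun (congrFun hA i) i
    simpa [Matrix.mul_apply, sq] using this
  rw [← e, ← Finset.sum_image (f := fun j => A i j ^ 2) (g := Fin.castLE h) (s := Finset.univ)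
    (fun a _ b _ hab => Fin.castLE_injective h hab)]
  exact Finset.sum_le_sum_of_subset_of_nonneg (Finset.subset_univ _) (fun i _ _ => sq_nonneg _)

/-- Von Neumann trace inequality: tr(Mᵀ N) ≤ Σ_i s_i σ_i. -/
theorem von_neumann_trace_inequality (n₁ n₂ : ℕ)
    (M N : Matrix (Fin n₁) (Fin n₂) ℝ)
    (U : Matrix (Fin n₁) (Fin n₁) ℝ) (V : Matrix (Fin n₂) (Fin n₂) ℝ)
    (Q : Matrix (Fin n₁) (Fin n₁) ℝ) (R : Matrix (Fin n₂) (Fin n₂) ℝ)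
    (s σ : ℕ → ℝ)
    (hU : Uᵀ * U = 1) (hU' : U * Uᵀ = 1)
    (hV : Vᵀ * V = 1) (hV' : V * Vᵀ = 1)
    (hQ : Qᵀ * Q = 1) (hQ' : Q * Qᵀ = 1)
    (hR : Rᵀ * R = 1) (hR' : R * Rᵀ = 1)
    (hsdesc : ∀ i j : ℕ, i ≤ j → j < min n₁ n₂ → s j ≤ s i)
    (hsnonneg : ∀ i : ℕ, i < min n₁ n₂ → 0 ≤ s i)
    (hσdesc : ∀ i j : ℕ, i ≤ j → j < min n₁ n₂ → σ j ≤ σ i)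
    (hσnonneg : ∀ i : ℕ, i < min n₁ n₂ → 0 ≤ σ i)
    (hM : M = U * rectDiag n₁ n₂ s * Vᵀ)
    (hN : N = Q * rectDiag n₁ n₂ σ * Rᵀ) :
    Matrix.trace (Mᵀ * N) ≤ ∑ i ∈ Finset.range (min n₁ n₂), s i * σ i := by
  set A := Uᵀ * Q with hA
  set B := Rᵀ * V with hB
  have A1 : A * Aᵀ = 1 := by
    rw [hA, Matrix.transpose_mul, Matrix.transpose_transpose, Matrix.mul_assoc,
      ← Matrix.mul_assoc Q, hQ', Matrix.one_mul, hU]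
  have A2 : Aᵀ * A = 1 := mul_eq_one_comm.1 A1
  have B1 : B * Bᵀ = 1 := by
    rw [hB, Matrix.transpose_mul, Matrix.transpose_transpose, Matrix.mul_assoc,
      ← Matrix.mul_assoc V, hV', Matrix.one_mul, hR]
  have B2 : Bᵀ * B = 1 := mul_eq_one_comm.1 B1
  have ht : Matrix.trace (Mᵀ * N)
      = Matrix.trace ((rectDiag n₁ n₂ s)ᵀ * (A * rectDiag n₁ n₂ σ * B)) := by
    rw [hM, hN, hA, hB]
    simp only [Matrix.transpose_mul, Matrix.transpose_transpose, Matrix.mul_assoc]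
    rw [Matrix.trace_mul_comm]
    simp only [Matrix.mul_assoc]
  have hX : ∀ i k, (A * rectDiag n₁ n₂ σ * B) i k
      = ∑ j : Fin (min n₁ n₂), σ j * (A i (Fin.castLE (min_le_left _ _) j)
          * B (Fin.castLE (min_le_right _ _) j) k) := by
    intro i k
    rw [← vn_rect n₁ n₂ σ (fun j l => A i j * B l k)]
    simp only [Matrix.mul_apply, Finset.sum_mul]
    rw [Finset.sum_comm]
    refine Finset.sum_congr rfl fun _ _ => Finset.sum_congr rfl fun _ _ => by ring
  have ht2 : Matrix.trace ((rectDiag n₁ n₂ s)ᵀ * (A * rectDiag n₁ n₂ σ * B))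
      = ∑ i, ∑ k, rectDiag n₁ n₂ s i k * (A * rectDiag n₁ n₂ σ * B) i k := by
    rw [Finset.sum_comm]
    rfl
  rw [ht, ht2, vn_rect n₁ n₂ s (fun i k => (A * rectDiag n₁ n₂ σ * B) i k)]
  simp only [hX, Finset.mul_sum]
  refine le_trans ?_ (vn_fin s σ (min n₁ n₂) (fun i j =>
    (A (Fin.castLE (min_le_left _ _) i) (Fin.castLE (min_le_left _ _) j) ^ 2
      + B (Fin.castLE (min_le_right _ _) j) (Fin.castLE (min_le_right _ _) i) ^ 2) / 2)
    hsdesc hsnonneg hσdesc hσnonneg (fun i j => by positivity) ?_ ?_)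
  · refine Finset.sum_le_sum fun i _ => Finset.sum_le_sum fun j _ => ?_
    refine mul_le_mul_of_nonneg_left (mul_le_mul_of_nonneg_left ?_ (hσnonneg j j.2))
      (hsnonneg i i.2)
    nlinarith [sq_nonneg (A (Fin.castLE (min_le_left _ _) i) (Fin.castLE (min_le_left _ _) j)
      - B (Fin.castLE (min_le_right _ _) j) (Fin.castLE (min_le_right _ _) i))]
  · intro i
    rw [← Finset.sum_div, Finset.sum_add_distrib]
    have h1 := vn_sq (min_le_left n₁ n₂) A A1 (Fin.castLE (min_le_left _ _) i)
    have h2 := vn_sq (min_le_right n₁ n₂) Bᵀ (by rw [Matrix.transpose_transpose, B2])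
      (Fin.castLE (min_le_right _ _) i)
    simp only [Matrix.transpose_apply] at h2
    linarith
  · intro j
    rw [← Finset.sum_div, Finset.sum_add_distrib]
    have h1 := vn_sq (min_le_left n₁ n₂) Aᵀ (by rw [Matrix.transpose_transpose, A2])
      (Fin.castLE (min_le_left _ _) j)
    have h2 := vn_sq (min_le_right n₁ n₂) B B1 (Fin.castLE (min_le_right _ _) j)
    simp only [Matrix.transpose_apply] at h1
    linarith
end

section
/- Let W and D be n₁×n₂ real matrices with singular value decompositions W = U Σ Vᵀ and D = Q S Rᵀ, where U, V, Q, R are orthogonal and Σ, S are rectangular diagonal with descending nonnegative diagonal entries σ₁ ≥ … ≥ σ_r ≥ 0 and s₁ ≥ … ≥ s_r ≥ 0, r = min{n₁,n₂}. Then ‖W − D‖_F² ≥ Σ_{i=1}^{r} (σ_i − s_i)². -/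
open Matrix

/-- Squared Frobenius norm. -/
def frobSq {n₁ n₂ : ℕ} (A : Matrix (Fin n₁) (Fin n₂) ℝ) : ℝ :=
  ∑ i, ∑ j, (A i j) ^ 2

lemma abel_aux (r : ℕ) (s d : ℕ → ℝ)
    (hs : ∀ i j : ℕ, i ≤ j → j < r → s j ≤ s i)
    (hd : ∀ k ≤ r, 0 ≤ ∑ i ∈ Finset.range k, d i) (n : ℕ) (hn : n < r) :
    s n * ∑ i ∈ Finset.range (n + 1), d i ≤ ∑ i ∈ Finset.range (n + 1), s i * d i := by
  induction n with
  | zero => simp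
  | succ n ih =>
    have h1 := ih (by omega)
    have h2 := hs n (n + 1) (by omega) hn
    have h3 := hd (n + 1) (by omega)
    rw [Finset.sum_range_succ, Finset.sum_range_succ (fun i => s i * d i)]
    have h4 := mul_le_mul_of_nonneg_right h2 h3
    linarith

lemma abel_nonneg (r : ℕ) (s d : ℕ → ℝ)
    (hs : ∀ i j : ℕ, i ≤ j → j < r → s j ≤ s i) (hs0 : ∀ i < r, 0 ≤ s i)
    (hd : ∀ k ≤ r, 0 ≤ ∑ i ∈ Finset.range k, d i) :
    0 ≤ ∑ i ∈ Finset.range r, s i * d i := by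
  cases r with
  | zero => simp
  | succ n =>
    exact le_trans (mul_nonneg (hs0 n (by omega)) (hd _ le_rfl))
      (abel_aux (n + 1) s d hs hd n (by omega))

lemma abel_le (r : ℕ) (s x y : ℕ → ℝ)
    (hs : ∀ i j : ℕ, i ≤ j → j < r → s j ≤ s i) (hs0 : ∀ i < r, 0 ≤ s i)
    (hd : ∀ k ≤ r, ∑ i ∈ Finset.range k, x i ≤ ∑ i ∈ Finset.range k, y i) :
    ∑ i ∈ Finset.range r, s i * x i ≤ ∑ i ∈ Finset.range r, s i * y i := by
  have := abel_nonneg r s (fun i => y i - x i) hs hs0 (fun k hk => by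
    rw [Finset.sum_sub_distrib]; linarith [hd k hk])
  simp only [mul_sub, Finset.sum_sub_distrib] at this
  linarith

lemma substoch_le (r : ℕ) (s t : ℕ → ℝ) (M : ℕ → ℕ → ℝ)
    (hs : ∀ i j : ℕ, i ≤ j → j < r → s j ≤ s i) (hs0 : ∀ i < r, 0 ≤ s i)
    (ht : ∀ i j : ℕ, i ≤ j → j < r → t j ≤ t i) (ht0 : ∀ i < r, 0 ≤ t i)
    (hM : ∀ i j, 0 ≤ M i j)
    (hrow : ∀ i < r, ∑ j ∈ Finset.range r, M i j ≤ 1)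
    (hcol : ∀ j < r, ∑ i ∈ Finset.range r, M i j ≤ 1) :
    ∑ i ∈ Finset.range r, s i * ∑ j ∈ Finset.range r, t j * M i j
      ≤ ∑ i ∈ Finset.range r, s i * t i := by
  apply abel_le r s _ _ hs hs0
  intro k hk
  rw [Finset.sum_comm]
  simp only [← Finset.mul_sum]
  have key := abel_le r t (fun j => ∑ i ∈ Finset.range k, M i j)
    (fun j => if j < k then 1 else 0) ht ht0 (by
      intro l hl
      have e : ∑ i ∈ Finset.range l, (if i < k then (1 : ℝ) else 0) = ((min k l : ℕ) : ℝ) := by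
        rw [← Finset.sum_filter]
        have : (Finset.range l).filter (fun i => i < k) = Finset.range (min k l) := by
          ext; simp; omega
        rw [this]; simp
      rw [e]
      have sub : ∀ a ≤ r, Finset.range a ⊆ Finset.range r := fun a ha =>
        Finset.range_subset_range.2 ha
      rcases le_total k l with h | h
      · rw [min_eq_left h, Finset.sum_comm]
        calc _ ≤ ∑ i ∈ Finset.range k, (1 : ℝ) := by
              apply Finset.sum_le_sum
              intro i hi
              exact le_trans (Finset.sum_le_sum_of_subset_of_nonneg (sub l hl)
                (fun j _ _ => hM i j)) (hrow i (by simp at hi; omega))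
          _ = k := by simp
      · rw [min_eq_right h]
        calc _ ≤ ∑ i ∈ Finset.range l, (1 : ℝ) := by
              apply Finset.sum_le_sum
              intro i hi
              exact le_trans (Finset.sum_le_sum_of_subset_of_nonneg (sub k hk)
                (fun j _ _ => hM j i)) (hcol i (by simp at hi; omega))
          _ = l := by simp)
  refine key.trans (le_of_eq ?_)
  simp only [mul_ite, mul_one, mul_zero]
  rw [← Finset.sum_filter]
  congr 1
  ext; simp; omega

lemma sum_rectDiag (n₁ n₂ : ℕ) (σ : ℕ → ℝ) (B : Fin n₁ → Fin n₂ → ℝ) :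
    ∑ i, ∑ j, rectDiag n₁ n₂ σ i j * B i j =
      ∑ k : Fin (min n₁ n₂), σ k * B (Fin.castLE (min_le_left _ _) k)
        (Fin.castLE (min_le_right _ _) k) := by
  rw [← Finset.sum_product']
  symm
  apply Finset.sum_of_injOn (fun k : Fin (min n₁ n₂) =>
    (Fin.castLE (min_le_left n₁ n₂) k, Fin.castLE (min_le_right n₁ n₂) k))
  · intro a _ b _ h
    simpa using h
  · intro a _; simp
  · rintro ⟨i, j⟩ _ h
    simp only [rectDiag]
    rw [if_neg, zero_mul]
    intro hij
    apply h
    refine ⟨⟨i, by have := i.2; have := j.2; omega⟩, by simp, ?_⟩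
    ext
    · rfl
    · exact hij
  · intro k _
    simp [rectDiag]

lemma frobSq_eq_trace {n₁ n₂ : ℕ} (A : Matrix (Fin n₁) (Fin n₂) ℝ) :
    frobSq A = (Aᵀ * A).trace := by
  simp only [frobSq, Matrix.trace, Matrix.mul_apply, Matrix.diag, Matrix.transpose_apply]
  rw [Finset.sum_comm]
  simp only [sq]

lemma frobSq_orth {n₁ n₂ : ℕ} (A : Matrix (Fin n₁) (Fin n₂) ℝ)
    (P : Matrix (Fin n₁) (Fin n₁) ℝ) (Z : Matrix (Fin n₂) (Fin n₂) ℝ)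
    (hP : Pᵀ * P = 1) (hZ : Zᵀ * Z = 1) : frobSq (P * A * Zᵀ) = frobSq A := by
  rw [frobSq_eq_trace, frobSq_eq_trace]
  have : (P * A * Zᵀ)ᵀ * (P * A * Zᵀ) = Z * (Aᵀ * A * Zᵀ) := by
    simp only [Matrix.transpose_mul, Matrix.transpose_transpose]
    calc _ = Z * (Aᵀ * (Pᵀ * P) * A * Zᵀ) := by simp only [Matrix.mul_assoc]
      _ = _ := by rw [hP, Matrix.mul_one]
  rw [this, Matrix.trace_mul_comm, Matrix.mul_assoc, hZ, Matrix.mul_one]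

lemma orth_row {n m : ℕ} (h : m ≤ n) (P : Matrix (Fin n) (Fin n) ℝ) (hP : P * Pᵀ = 1)
    (i : Fin n) : ∑ j : Fin m, P i (Fin.castLE h j) ^ 2 ≤ 1 := by
  have h1 : ∑ j, P i j ^ 2 = 1 := by
    have := congrFun (congrFun hP i) i
    simpa [Matrix.mul_apply, sq] using this
  have h2 := Finset.sum_map Finset.univ (Fin.castLEEmb h) (fun j => P i j ^ 2)
  rw [← h1]
  refine le_trans (le_of_eq h2.symm) ?_
  exact Finset.sum_le_sum_of_subset_of_nonneg (Finset.subset_univ _) (fun _ _ _ => sq_nonneg _)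

lemma cross_le (n₁ n₂ : ℕ) (P : Matrix (Fin n₁) (Fin n₁) ℝ) (Z : Matrix (Fin n₂) (Fin n₂) ℝ)
    (σ s : ℕ → ℝ)
    (hP : Pᵀ * P = 1) (hP' : P * Pᵀ = 1) (hZ : Zᵀ * Z = 1) (hZ' : Z * Zᵀ = 1)
    (hσ : ∀ i j : ℕ, i ≤ j → j < min n₁ n₂ → σ j ≤ σ i)
    (hσ0 : ∀ i : ℕ, i < min n₁ n₂ → 0 ≤ σ i)
    (hs : ∀ i j : ℕ, i ≤ j → j < min n₁ n₂ → s j ≤ s i)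
    (hs0 : ∀ i : ℕ, i < min n₁ n₂ → 0 ≤ s i) :
    ∑ i, ∑ j, rectDiag n₁ n₂ s i j * (P * rectDiag n₁ n₂ σ * Zᵀ) i j
      ≤ ∑ i ∈ Finset.range (min n₁ n₂), s i * σ i := by
  have hX : ∀ a b, (P * rectDiag n₁ n₂ σ * Zᵀ) a b =
      ∑ k : Fin (min n₁ n₂), σ k * (P a (Fin.castLE (min_le_left _ _) k) *
        Z b (Fin.castLE (min_le_right _ _) k)) := by
    intro a b
    rw [← sum_rectDiag n₁ n₂ σ (fun i j => P a i * Z b j)]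
    simp only [Matrix.mul_apply, Matrix.transpose_apply, Finset.sum_mul]
    rw [Finset.sum_comm]
    refine Finset.sum_congr rfl fun i _ => Finset.sum_congr rfl fun j _ => by ring
  rw [sum_rectDiag n₁ n₂ s (fun i j => (P * rectDiag n₁ n₂ σ * Zᵀ) i j)]
  simp only [hX]
  let e₁ : Fin (min n₁ n₂) → Fin n₁ := Fin.castLE (min_le_left _ _)
  let e₂ : Fin (min n₁ n₂) → Fin n₂ := Fin.castLE (min_le_right _ _)
  let M : ℕ → ℕ → ℝ := fun i j => if h : i < min n₁ n₂ ∧ j < min n₁ n₂ then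
    (P (e₁ ⟨i, h.1⟩) (e₁ ⟨j, h.2⟩) ^ 2 + Z (e₂ ⟨i, h.1⟩) (e₂ ⟨j, h.2⟩) ^ 2) / 2 else 0
  have hMf : ∀ i j : Fin (min n₁ n₂), M i j =
      (P (e₁ i) (e₁ j) ^ 2 + Z (e₂ i) (e₂ j) ^ 2) / 2 := by
    intro i j
    exact dif_pos ⟨i.2, j.2⟩
  have key := substoch_le (min n₁ n₂) s σ M hs hs0 hσ hσ0
    (by
      intro i j
      simp only [M]
      split_ifs
      · positivity
      · exact le_rfl)
    (by
      intro i hi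
      rw [Finset.sum_range]
      have : ∀ j : Fin (min n₁ n₂), M i j = _ := fun j => hMf ⟨i, hi⟩ j
      simp only [this]
      rw [← Finset.sum_div, Finset.sum_add_distrib]
      have h1 := orth_row (min_le_left n₁ n₂) P hP' (e₁ ⟨i, hi⟩)
      have h2 := orth_row (min_le_right n₁ n₂) Z hZ' (e₂ ⟨i, hi⟩)
      simp only [e₁, e₂] at *
      linarith)
    (by
      intro i hi
      rw [Finset.sum_range]
      have : ∀ j : Fin (min n₁ n₂), M j i = _ := fun j => hMf j ⟨i, hi⟩
      simp only [this]
      rw [← Finset.sum_div, Finset.sum_add_distrib]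
      have h1 := orth_row (min_le_left n₁ n₂) Pᵀ (by simpa using hP) (e₁ ⟨i, hi⟩)
      have h2 := orth_row (min_le_right n₁ n₂) Zᵀ (by simpa using hZ) (e₂ ⟨i, hi⟩)
      simp only [e₁, e₂, Matrix.transpose_apply] at *
      linarith)
  refine le_trans ?_ key
  rw [Finset.sum_range]
  refine Finset.sum_le_sum fun i _ => mul_le_mul_of_nonneg_left ?_ (hs0 i i.2)
  rw [Finset.sum_range]
  refine Finset.sum_le_sum fun j _ => mul_le_mul_of_nonneg_left ?_ (hσ0 j j.2)
  rw [hMf]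
  have := sq_nonneg (P (e₁ i) (e₁ j) - Z (e₂ i) (e₂ j))
  simp only [e₁, e₂] at *
  nlinarith

lemma frobSq_rectDiag (n₁ n₂ : ℕ) (σ : ℕ → ℝ) :
    frobSq (rectDiag n₁ n₂ σ) = ∑ i ∈ Finset.range (min n₁ n₂), σ i ^ 2 := by
  simp only [frobSq, sq]
  rw [sum_rectDiag n₁ n₂ σ (fun i j => rectDiag n₁ n₂ σ i j), Finset.sum_range]
  simp [rectDiag]

/-- ‖W − D‖_F² ≥ Σ_{i=1}^{r} (σ_i − s_i)². -/
theorem frobSq_sub_ge_sum_sq_sub_singular_values (n₁ n₂ : ℕ)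
    (W D : Matrix (Fin n₁) (Fin n₂) ℝ)
    (U : Matrix (Fin n₁) (Fin n₁) ℝ) (V : Matrix (Fin n₂) (Fin n₂) ℝ)
    (Q : Matrix (Fin n₁) (Fin n₁) ℝ) (R : Matrix (Fin n₂) (Fin n₂) ℝ)
    (σ s : ℕ → ℝ)
    (hU : Uᵀ * U = 1) (hU' : U * Uᵀ = 1)
    (hV : Vᵀ * V = 1) (hV' : V * Vᵀ = 1)
    (hQ : Qᵀ * Q = 1) (hQ' : Q * Qᵀ = 1)
    (hR : Rᵀ * R = 1) (hR' : R * Rᵀ = 1)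
    (hσdesc : ∀ i j : ℕ, i ≤ j → j < min n₁ n₂ → σ j ≤ σ i)
    (hσnonneg : ∀ i : ℕ, i < min n₁ n₂ → 0 ≤ σ i)
    (hsdesc : ∀ i j : ℕ, i ≤ j → j < min n₁ n₂ → s j ≤ s i)
    (hsnonneg : ∀ i : ℕ, i < min n₁ n₂ → 0 ≤ s i)
    (hW : W = U * rectDiag n₁ n₂ σ * Vᵀ)
    (hD : D = Q * rectDiag n₁ n₂ s * Rᵀ) :
    ∑ i ∈ Finset.range (min n₁ n₂), (σ i - s i) ^ 2 ≤ frobSq (W - D) := by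
  have hP : (Qᵀ * U)ᵀ * (Qᵀ * U) = 1 := by
    calc _ = Uᵀ * (Q * Qᵀ) * U := by simp [Matrix.mul_assoc]
      _ = 1 := by rw [hQ', Matrix.mul_one, hU]
  have hZ : (Rᵀ * V)ᵀ * (Rᵀ * V) = 1 := by
    calc _ = Vᵀ * (R * Rᵀ) * V := by simp [Matrix.mul_assoc]
      _ = 1 := by rw [hR', Matrix.mul_one, hV]
  have hP' := mul_eq_one_comm.1 hP
  have hZ' := mul_eq_one_comm.1 hZ
  have hc := cross_le n₁ n₂ (Qᵀ * U) (Rᵀ * V) σ s hP hP' hZ hZ' hσdesc hσnonneg hsdesc hsnonneg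
  have hX := frobSq_orth (rectDiag n₁ n₂ σ) (Qᵀ * U) (Rᵀ * V) hP hZ
  have hWD : W - D = Q * (Qᵀ * U * rectDiag n₁ n₂ σ * (Rᵀ * V)ᵀ - rectDiag n₁ n₂ s) * Rᵀ := by
    rw [hW, hD, Matrix.mul_sub, Matrix.sub_mul]
    congr 1
    symm
    calc _ = (Q * Qᵀ) * U * rectDiag n₁ n₂ σ * Vᵀ * (R * Rᵀ) := by
          simp [Matrix.mul_assoc]
      _ = _ := by rw [hQ', hR', Matrix.one_mul, Matrix.mul_one]
  rw [hWD, frobSq_orth _ Q R hQ hR]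
  generalize Qᵀ * U * rectDiag n₁ n₂ σ * (Rᵀ * V)ᵀ = X at *
  have hexp : frobSq (X - rectDiag n₁ n₂ s) = frobSq X
      - 2 * ∑ i, ∑ j, rectDiag n₁ n₂ s i j * X i j + frobSq (rectDiag n₁ n₂ s) := by
    simp only [frobSq, Finset.mul_sum, ← Finset.sum_sub_distrib, ← Finset.sum_add_distrib]
    refine Finset.sum_congr rfl fun i _ => Finset.sum_congr rfl fun j _ => ?_
    rw [Matrix.sub_apply]; ring
  rw [hexp, hX, frobSq_rectDiag, frobSq_rectDiag]
  have : ∑ i ∈ Finset.range (min n₁ n₂), (σ i - s i) ^ 2 =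
      ∑ i ∈ Finset.range (min n₁ n₂), σ i ^ 2 - 2 * ∑ i ∈ Finset.range (min n₁ n₂), s i * σ i
        + ∑ i ∈ Finset.range (min n₁ n₂), s i ^ 2 := by
    simp only [Finset.mul_sum, ← Finset.sum_sub_distrib, ← Finset.sum_add_distrib]
    refine Finset.sum_congr rfl fun i _ => by ring
  rw [this]
  linarith
end

section
/- (X-subproblem sufficient decrease) Let Ω be a subset of the index set {1,…,n₁}×{1,…,n₂}, let ρ > 0, and let W, ℰ, F, E, Y, μ₁, μ₃ be fixed n₁×n₂ real matrices. Define f(X) = (ρ/2)‖W − X + μ₁/ρ‖_F² + (ρ/2)‖F − (Y_Ω − X_Ω − ℰ_Ω) + μ₃/ρ‖_F². If X⁺ minimizes f over all n₁×n₂ real matrices, then for every n₁×n₂ real matrix X, f(X⁺) − f(X) ≤ −(ρ/2)‖X⁺ − X‖_F² − (ρ/2)‖X⁺_Ω − X_Ω‖_F². -/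
open Matrix

/-- `proj Ω A` agrees with `A` on `Ω` and is zero outside `Ω`. -/
def proj {n₁ n₂ : ℕ} (Ω : Finset (Fin n₁ × Fin n₂))
    (A : Matrix (Fin n₁) (Fin n₂) ℝ) : Matrix (Fin n₁) (Fin n₂) ℝ :=
  fun i j => if (i, j) ∈ Ω then A i j else 0

/-- X-subproblem sufficient decrease. -/
theorem X_subproblem_sufficient_decrease (n₁ n₂ : ℕ)
    (Ω : Finset (Fin n₁ × Fin n₂)) (ρ : ℝ) (hρ : 0 < ρ)
    (W ℰ F E Y μ₁ μ₃ : Matrix (Fin n₁) (Fin n₂) ℝ)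
    (f : Matrix (Fin n₁) (Fin n₂) ℝ → ℝ)
    (hf : ∀ X : Matrix (Fin n₁) (Fin n₂) ℝ,
      f X = ρ / 2 * frobSq (W - X + ρ⁻¹ • μ₁) +
        ρ / 2 * frobSq (F - (proj Ω Y - proj Ω X - proj Ω ℰ) + ρ⁻¹ • μ₃))
    (Xp : Matrix (Fin n₁) (Fin n₂) ℝ)
    (hmin : ∀ X : Matrix (Fin n₁) (Fin n₂) ℝ, f Xp ≤ f X) :
    ∀ X : Matrix (Fin n₁) (Fin n₂) ℝ,
      f Xp - f X ≤ -(ρ / 2) * frobSq (Xp - X) - ρ / 2 * frobSq (proj Ω Xp - proj Ω X) := by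
  intro X
  have key : ∀ (A B : Matrix (Fin n₁) (Fin n₂) ℝ) (t : ℝ),
      frobSq (A + t • B) = frobSq A + t * (2 * ∑ i, ∑ j, A i j * B i j) + t ^ 2 * frobSq B := by
    intro A B t
    simp only [frobSq, Finset.mul_sum, ← Finset.sum_add_distrib]
    refine Finset.sum_congr rfl fun i _ => Finset.sum_congr rfl fun j _ => ?_
    simp only [Matrix.add_apply, Matrix.smul_apply, smul_eq_mul]
    ring
  have nn : ∀ A : Matrix (Fin n₁) (Fin n₂) ℝ, 0 ≤ frobSq A := fun A =>
    Finset.sum_nonneg fun i _ => Finset.sum_nonneg fun j _ => sq_nonneg _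
  have hQ1 := nn (Xp - X)
  have hQ2 := nn (proj Ω Xp - proj Ω X)
  obtain ⟨L, hL⟩ : ∃ L : ℝ, ∀ t : ℝ, f (Xp + t • (X - Xp)) = f Xp + t * L +
      t ^ 2 * (ρ / 2 * frobSq (Xp - X) + ρ / 2 * frobSq (proj Ω Xp - proj Ω X)) := by
    refine ⟨ρ / 2 * (2 * ∑ i, ∑ j, (W - Xp + ρ⁻¹ • μ₁) i j * (Xp - X) i j) +
      ρ / 2 * (2 * ∑ i, ∑ j, (F - (proj Ω Y - proj Ω Xp - proj Ω ℰ) + ρ⁻¹ • μ₃) i j *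
        (-(proj Ω Xp - proj Ω X)) i j), fun t => ?_⟩
    have e1 : W - (Xp + t • (X - Xp)) + ρ⁻¹ • μ₁ = (W - Xp + ρ⁻¹ • μ₁) + t • (Xp - X) := by
      ext i j
      simp only [Matrix.add_apply, Matrix.sub_apply, Matrix.smul_apply, smul_eq_mul]
      ring
    have e2 : F - (proj Ω Y - proj Ω (Xp + t • (X - Xp)) - proj Ω ℰ) + ρ⁻¹ • μ₃ =
        (F - (proj Ω Y - proj Ω Xp - proj Ω ℰ) + ρ⁻¹ • μ₃) +
          t • (-(proj Ω Xp - proj Ω X)) := by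
      ext i j
      simp only [Matrix.add_apply, Matrix.sub_apply, Matrix.smul_apply, Matrix.neg_apply,
        smul_eq_mul, proj]
      split_ifs <;> ring
    have e3 : frobSq (-(proj Ω Xp - proj Ω X)) = frobSq (proj Ω Xp - proj Ω X) := by
      simp only [frobSq, Matrix.neg_apply, neg_sq]
    rw [hf, hf, e1, e2, key _ (Xp - X), key _ (-(proj Ω Xp - proj Ω X)), e3]
    ring
  have hQ : 0 ≤ ρ / 2 * frobSq (Xp - X) + ρ / 2 * frobSq (proj Ω Xp - proj Ω X) := by
    positivity
  have h1 := hL 1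
  rw [one_smul, add_sub_cancel] at h1
  generalize hq : ρ / 2 * frobSq (Xp - X) + ρ / 2 * frobSq (proj Ω Xp - proj Ω X) = Q at *
  have hL0 : 0 ≤ L := by
    by_contra hneg
    push Not at hneg
    have h2 := hmin (Xp + (-L / (Q + 1)) • (X - Xp))
    rw [hL] at h2
    have hp : 0 < Q + 1 := by linarith
    have h3 : -L / (Q + 1) * L + (-L / (Q + 1)) ^ 2 * Q = -(L / (Q + 1)) ^ 2 := by
      field_simp
      ring
    have h4 : 0 < (L / (Q + 1)) ^ 2 := by
      have : L / (Q + 1) ≠ 0 := div_ne_zero hneg.ne hp.ne'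
      positivity
    linarith
  linarith
end

section
/- (ℰ-subproblem sufficient decrease) Let Ω be a subset of the index set {1,…,n₁}×{1,…,n₂}, let ρ > 0, and let E, X, F, Y, μ₂, μ₃ be fixed n₁×n₂ real matrices. Define f(ℰ) = (ρ/2)‖E − ℰ + μ₂/ρ‖_F² + (ρ/2)‖F − (Y_Ω − X_Ω − ℰ_Ω) + μ₃/ρ‖_F². If ℰ⁺ minimizes f over all n₁×n₂ real matrices, then for every n₁×n₂ real matrix ℰ, f(ℰ⁺) − f(ℰ) ≤ −(ρ/2)‖ℰ⁺ − ℰ‖_F² − (ρ/2)‖ℰ⁺_Ω − ℰ_Ω‖_F². -/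
open Matrix

lemma frobSq_segment {n₁ n₂ : ℕ} (A B C D : Matrix (Fin n₁) (Fin n₂) ℝ) (t : ℝ)
    (hC : ∀ i j, C i j = (1 - t) * A i j + t * B i j)
    (hD : ∀ i j, (D i j) ^ 2 = (A i j - B i j) ^ 2) :
    frobSq C = (1 - t) * frobSq A + t * frobSq B - t * (1 - t) * frobSq D := by
  unfold frobSq
  simp only [Finset.mul_sum, ← Finset.sum_add_distrib, ← Finset.sum_sub_distrib]
  refine Finset.sum_congr rfl fun i _ => Finset.sum_congr rfl fun j _ => ?_
  rw [hC, hD]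
  ring

/-- ℰ-subproblem sufficient decrease. -/
theorem E_error_subproblem_sufficient_decrease (n₁ n₂ : ℕ)
    (Ω : Finset (Fin n₁ × Fin n₂)) (ρ : ℝ) (hρ : 0 < ρ)
    (E X F Y μ₂ μ₃ : Matrix (Fin n₁) (Fin n₂) ℝ)
    (f : Matrix (Fin n₁) (Fin n₂) ℝ → ℝ)
    (hf : ∀ ℰ : Matrix (Fin n₁) (Fin n₂) ℝ,
      f ℰ = ρ / 2 * frobSq (E - ℰ + ρ⁻¹ • μ₂) +
        ρ / 2 * frobSq (F - (proj Ω Y - proj Ω X - proj Ω ℰ) + ρ⁻¹ • μ₃))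
    (ℰp : Matrix (Fin n₁) (Fin n₂) ℝ)
    (hmin : ∀ ℰ : Matrix (Fin n₁) (Fin n₂) ℝ, f ℰp ≤ f ℰ) :
    ∀ ℰ : Matrix (Fin n₁) (Fin n₂) ℝ,
      f ℰp - f ℰ ≤ -(ρ / 2) * frobSq (ℰp - ℰ) - ρ / 2 * frobSq (proj Ω ℰp - proj Ω ℰ) := by
  intro ℰ
  have key : ∀ t : ℝ, f ((1 - t) • ℰp + t • ℰ) = (1 - t) * f ℰp + t * f ℰ -
      t * (1 - t) * (ρ / 2 * frobSq (ℰp - ℰ) + ρ / 2 * frobSq (proj Ω ℰp - proj Ω ℰ)) := by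
    intro t
    rw [hf, hf ℰp, hf ℰ,
      frobSq_segment (E - ℰp + ρ⁻¹ • μ₂) (E - ℰ + ρ⁻¹ • μ₂)
        (E - ((1 - t) • ℰp + t • ℰ) + ρ⁻¹ • μ₂) (ℰp - ℰ) t
        (by intro i j; simp; ring) (by intro i j; simp; ring),
      frobSq_segment (F - (proj Ω Y - proj Ω X - proj Ω ℰp) + ρ⁻¹ • μ₃)
        (F - (proj Ω Y - proj Ω X - proj Ω ℰ) + ρ⁻¹ • μ₃)
        (F - (proj Ω Y - proj Ω X - proj Ω ((1 - t) • ℰp + t • ℰ)) + ρ⁻¹ • μ₃)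
        (proj Ω ℰp - proj Ω ℰ) t
        (by intro i j; by_cases h : (i, j) ∈ Ω <;> simp [proj, h] <;> ring)
        (by intro i j; by_cases h : (i, j) ∈ Ω <;> simp [proj, h])]
    ring
  set Q := ρ / 2 * frobSq (ℰp - ℰ) + ρ / 2 * frobSq (proj Ω ℰp - proj Ω ℰ) with hQ
  suffices h : Q ≤ f ℰ - f ℰp by linarith
  by_contra hlt
  push Not at hlt
  have h0 := hmin ℰ
  have hQ0 : 0 < Q := by linarith
  obtain ⟨t, ht⟩ : ∃ t : ℝ, t = (Q - (f ℰ - f ℰp)) / (2 * Q) := ⟨_, rfl⟩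
  have htpos : 0 < t := by rw [ht]; apply div_pos <;> linarith
  have htQ : t * Q = (Q - (f ℰ - f ℰp)) / 2 := by rw [ht]; field_simp
  have h1 := hmin ((1 - t) • ℰp + t • ℰ)
  rw [key t] at h1
  have h2 : 0 ≤ t * ((f ℰ - f ℰp) - (Q - t * Q)) := by linarith
  have h3 := nonneg_of_mul_nonneg_right h2 htpos
  linarith
end

section
/- (Bound on the Lagrangian increase from the multiplier updates) Let α, λ, ρ > 0, and let R, φ be differentiable real-valued functions on n₁×n₂ real matrices whose gradients (with respect to the trace inner product) are Lipschitz with constants S₁ and S₂ respectively. Let W, W⁺, E, E⁺, F, F⁺, X⁺, ℰ⁺, Y be n₁×n₂ real matrices, Ω an index set, and suppose the multipliers satisfy μ₁ = −α∇R(W), μ₁⁺ = −α∇R(W⁺), μ₁⁺ = μ₁ + ρ(W⁺ − X⁺); μ₂ = −λ∇φ(E), μ₂⁺ = −λ∇φ(E⁺), μ₂⁺ = μ₂ + ρ(E⁺ − ℰ⁺); μ₃ = −F, μ₃⁺ = −F⁺, μ₃⁺ = μ₃ + ρ(F⁺ − (Y_Ω − X⁺_Ω − ℰ⁺_Ω)).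 Then ⟨μ₁⁺ − μ₁, W⁺ − X⁺⟩ + ⟨μ₂⁺ − μ₂, E⁺ − ℰ⁺⟩ + ⟨μ₃⁺ − μ₃, F⁺ − Y_Ω + X⁺_Ω + ℰ⁺_Ω⟩ ≤ (α²S₁²/ρ)‖W⁺ − W‖_F² + (λ²S₂²/ρ)‖E⁺ − E‖_F² + (1/ρ)‖F⁺ − F‖_F². -/
open Matrix

/-- Trace inner product ⟨A,B⟩ = tr(AᵀB). -/
def tip {n₁ n₂ : ℕ} (A B : Matrix (Fin n₁) (Fin n₂) ℝ) : ℝ :=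
  Matrix.trace (Aᵀ * B)

theorem tip_eq_frobSq_div {n₁ n₂ : ℕ} (ρ : ℝ) (hρ : 0 < ρ)
    (m mp V : Matrix (Fin n₁) (Fin n₂) ℝ) (h : mp = m + ρ • V) :
    tip (mp - m) V = 1 / ρ * frobSq (mp - m) := by
  subst h
  simp only [tip, frobSq, Matrix.trace, Matrix.diag, Matrix.mul_apply, Matrix.transpose_apply,
    add_sub_cancel_left, Matrix.smul_apply, smul_eq_mul]
  rw [Finset.sum_comm, Finset.mul_sum]
  refine Finset.sum_congr rfl fun i _ => ?_
  rw [Finset.mul_sum]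
  refine Finset.sum_congr rfl fun j _ => ?_
  field_simp

theorem frobSq_nonneg {n₁ n₂ : ℕ} (A : Matrix (Fin n₁) (Fin n₂) ℝ) : 0 ≤ frobSq A :=
  Finset.sum_nonneg fun _ _ => Finset.sum_nonneg fun _ _ => sq_nonneg _

theorem frobSq_neg_smul_sub {n₁ n₂ : ℕ} (c : ℝ) (A B : Matrix (Fin n₁) (Fin n₂) ℝ) :
    frobSq (-(c • A) - -(c • B)) = c ^ 2 * frobSq (A - B) := by
  simp only [frobSq, Finset.mul_sum, Matrix.sub_apply, Matrix.neg_apply, Matrix.smul_apply,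
    smul_eq_mul]
  refine Finset.sum_congr rfl fun i _ => Finset.sum_congr rfl fun j _ => ?_
  ring

theorem tip_grad_bound {n₁ n₂ : ℕ} (ρ c S : ℝ) (hρ : 0 < ρ)
    (A B P Q m mp V : Matrix (Fin n₁) (Fin n₂) ℝ)
    (hS : Real.sqrt (frobSq (A - B)) ≤ S * Real.sqrt (frobSq (P - Q)))
    (hm : m = -(c • B)) (hmp : mp = -(c • A)) (h : mp = m + ρ • V) :
    tip (mp - m) V ≤ c ^ 2 * S ^ 2 / ρ * frobSq (P - Q) := by
  rw [tip_eq_frobSq_div ρ hρ m mp V h, hm, hmp, frobSq_neg_smul_sub]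
  have h2 : frobSq (A - B) ≤ S ^ 2 * frobSq (P - Q) := by
    have := pow_le_pow_left₀ (Real.sqrt_nonneg _) hS 2
    rwa [mul_pow, Real.sq_sqrt (frobSq_nonneg _), Real.sq_sqrt (frobSq_nonneg _)] at this
  calc 1 / ρ * (c ^ 2 * frobSq (A - B)) ≤ 1 / ρ * (c ^ 2 * (S ^ 2 * frobSq (P - Q))) := by gcongr
    _ = _ := by ring

/-- Bound on the Lagrangian increase from the multiplier updates. -/
theorem multiplier_update_increase_bound (n₁ n₂ : ℕ)
    (Ω : Finset (Fin n₁ × Fin n₂))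
    (α lam ρ S₁ S₂ : ℝ) (hα : 0 < α) (hlam : 0 < lam) (hρ : 0 < ρ)
    (R φ : Matrix (Fin n₁) (Fin n₂) ℝ → ℝ)
    (gradR gradφ : Matrix (Fin n₁) (Fin n₂) ℝ → Matrix (Fin n₁) (Fin n₂) ℝ)
    (hRdiff : ∀ W V : Matrix (Fin n₁) (Fin n₂) ℝ,
      HasDerivAt (fun t : ℝ => R (W + t • V)) (tip (gradR W) V) 0)
    (hφdiff : ∀ E V : Matrix (Fin n₁) (Fin n₂) ℝ,
      HasDerivAt (fun t : ℝ => φ (E + t • V)) (tip (gradφ E) V) 0)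
    (hS₁ : ∀ W₁ W₂ : Matrix (Fin n₁) (Fin n₂) ℝ,
      Real.sqrt (frobSq (gradR W₁ - gradR W₂)) ≤ S₁ * Real.sqrt (frobSq (W₁ - W₂)))
    (hS₂ : ∀ E₁ E₂ : Matrix (Fin n₁) (Fin n₂) ℝ,
      Real.sqrt (frobSq (gradφ E₁ - gradφ E₂)) ≤ S₂ * Real.sqrt (frobSq (E₁ - E₂)))
    (W Wp E Ep F Fp Xp ℰp Y μ₁ μ₁p μ₂ μ₂p μ₃ μ₃p : Matrix (Fin n₁) (Fin n₂) ℝ)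
    (h₁ : μ₁ = -(α • gradR W)) (h₁p : μ₁p = -(α • gradR Wp))
    (h₁u : μ₁p = μ₁ + ρ • (Wp - Xp))
    (h₂ : μ₂ = -(lam • gradφ E)) (h₂p : μ₂p = -(lam • gradφ Ep))
    (h₂u : μ₂p = μ₂ + ρ • (Ep - ℰp))
    (h₃ : μ₃ = -F) (h₃p : μ₃p = -Fp)
    (h₃u : μ₃p = μ₃ + ρ • (Fp - (proj Ω Y - proj Ω Xp - proj Ω ℰp))) :
    tip (μ₁p - μ₁) (Wp - Xp) + tip (μ₂p - μ₂) (Ep - ℰp) +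
        tip (μ₃p - μ₃) (Fp - proj Ω Y + proj Ω Xp + proj Ω ℰp) ≤
      α ^ 2 * S₁ ^ 2 / ρ * frobSq (Wp - W) + lam ^ 2 * S₂ ^ 2 / ρ * frobSq (Ep - E) +
        1 / ρ * frobSq (Fp - F) := by
  have e1 := tip_grad_bound ρ α S₁ hρ _ _ _ _ μ₁ μ₁p _ (hS₁ Wp W) h₁ h₁p h₁u
  have e2 := tip_grad_bound ρ lam S₂ hρ _ _ _ _ μ₂ μ₂p _ (hS₂ Ep E) h₂ h₂p h₂u
  have hV : Fp - proj Ω Y + proj Ω Xp + proj Ω ℰp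
      = Fp - (proj Ω Y - proj Ω Xp - proj Ω ℰp) := by abel
  have e3 := tip_eq_frobSq_div ρ hρ μ₃ μ₃p _ h₃u
  have e4 : frobSq (μ₃p - μ₃) = frobSq (Fp - F) := by
    have := frobSq_neg_smul_sub 1 Fp F
    simpa [h₃, h₃p] using this
  rw [hV, e3, e4]
  linarith
end
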